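/- arXiv:1507.07902 — 2 statements merged into one kernel-verified Lean document; each statement's English description precedes it below -/
import Mathlib

section
/- Assume Θ is compact and g(x,β) is twice differentiable with respect to β for all x. For the normal–truncated-normal pseudo conditional density and for the normal–exponential pseudo conditional density, for every α > 0 there exists a constant C such that for all θ ∈ Θ and all (x,y): ‖∂²_{θθᵀ} H_α(x,y;θ)‖ ≤ C (1+α) (1 + sup_{θ∈Θ} ‖∂_β g(x,β) ∂_{βᵀ} g(x,β)‖ + sup_{θ∈Θ} ‖∂²_{ββᵀ} g(x,β)‖). -/
open MeasureTheory ProbabilityTheory Real Set Filter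
open scoped ENNReal NNReal

/-- The standard normal density φ(t) = (2π)^{-1/2} e^{-t²/2}. -/
noncomputable def stdGaussPdf (t : ℝ) : ℝ := (Real.sqrt (2 * Real.pi))⁻¹ * Real.exp (-(t ^ 2) / 2)

/-- The standard normal cumulative distribution function Φ. -/
noncomputable def stdGaussCdf (t : ℝ) : ℝ := ∫ s in Set.Iic t, stdGaussPdf s

/-- The normal–truncated-normal pseudo conditional density
f_θ(y|x) = (1/σ)[1−Φ(−μ/σ_u)]⁻¹ φ((y−g(x,β)+μ)/σ) Φ(μ/(σλ) − λ(y−g(x,β))/σ),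
with σ² = σ_v² + σ_u², λ = σ_u/σ_v, and θ = (β, μ, σ_v, σ_u). -/
noncomputable def fNT {p q : ℕ} (g : (Fin p → ℝ) → (Fin q → ℝ) → ℝ)
    (θ : (Fin q → ℝ) × ℝ × ℝ × ℝ) (x : Fin p → ℝ) (y : ℝ) : ℝ :=
  let β := θ.1; let μ := θ.2.1; let σv := θ.2.2.1; let σu := θ.2.2.2
  let σ := Real.sqrt (σv ^ 2 + σu ^ 2)
  let lam := σu / σv
  σ⁻¹ * (1 - stdGaussCdf (-(μ / σu)))⁻¹ * stdGaussPdf ((y - g x β + μ) / σ) *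
    stdGaussCdf (μ / (σ * lam) - lam * (y - g x β) / σ)

/-- The normal–exponential pseudo conditional density
f_θ(y|x) = (1/σ_u) Φ(−(y−g(x,β))/σ_v − σ_v/σ_u) exp((y−g(x,β))/σ_u + σ_v²/(2σ_u²)),
with θ = (β, σ_v, σ_u). -/
noncomputable def fNE {p q : ℕ} (g : (Fin p → ℝ) → (Fin q → ℝ) → ℝ)
    (θ : (Fin q → ℝ) × ℝ × ℝ) (x : Fin p → ℝ) (y : ℝ) : ℝ :=
  let β := θ.1; let σv := θ.2.1; let σu := θ.2.2
  σu⁻¹ * stdGaussCdf (-((y - g x β) / σv) - σv / σu) *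
    Real.exp ((y - g x β) / σu + σv ^ 2 / (2 * σu ^ 2))

/-- The objective function H_α(x,y;θ) = ∫ f_θ^{1+α}(y'|x) dy' − (1+1/α) f_θ^α(y|x)
of the minimum density power divergence estimator. -/
noncomputable def dpdH {P XS : Type*} (a : ℝ) (f : P → XS → ℝ → ℝ)
    (θ : P) (x : XS) (y : ℝ) : ℝ :=
  (∫ y' : ℝ, f θ x y' ^ (1 + a)) - (1 + 1 / a) * f θ x y ^ a

/-- The compact parameter box Θ = [b̲,b̄]^q × [u̲,ū] × [σ̲,σ̄]² of the
normal–truncated-normal specification. -/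
def boxNT (q : ℕ) (bl bu ul uu sl su : ℝ) : Set ((Fin q → ℝ) × ℝ × ℝ × ℝ) :=
  (Set.Icc (fun _ => bl) (fun _ => bu)) ×ˢ ((Set.Icc ul uu) ×ˢ ((Set.Icc sl su) ×ˢ (Set.Icc sl su)))

/-- The compact parameter box Θ = [b̲,b̄]^q × [σ̲,σ̄]² of the normal–exponential
specification. -/
def boxNE (q : ℕ) (bl bu sl su : ℝ) : Set ((Fin q → ℝ) × ℝ × ℝ) :=
  (Set.Icc (fun _ => bl) (fun _ => bu)) ×ˢ ((Set.Icc sl su) ×ˢ (Set.Icc sl su))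

open scoped Topology

lemma stdGaussPdf_pos (t : ℝ) : 0 < stdGaussPdf t := by
  unfold stdGaussPdf; positivity

lemma stdGaussPdf_eq_gaussianPDFReal (t : ℝ) : stdGaussPdf t = gaussianPDFReal 0 1 t := by
  simp [stdGaussPdf, gaussianPDFReal]

lemma integrable_stdGaussPdf : Integrable stdGaussPdf := by
  rw [funext stdGaussPdf_eq_gaussianPDFReal]
  exact integrable_gaussianPDFReal 0 1

lemma integral_stdGaussPdf : ∫ t, stdGaussPdf t = 1 := by
  simp_rw [stdGaussPdf_eq_gaussianPDFReal]
  exact integral_gaussianPDFReal_eq_one 0 one_ne_zero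

lemma stdGaussPdf_neg (t : ℝ) : stdGaussPdf (-t) = stdGaussPdf t := by
  simp [stdGaussPdf]

lemma contDiff_stdGaussPdf {n : ℕ∞} : ContDiff ℝ n stdGaussPdf := by
  unfold stdGaussPdf
  fun_prop

lemma continuous_stdGaussPdf : Continuous stdGaussPdf :=
  (contDiff_stdGaussPdf (n := 0)).continuous

lemma hasDerivAt_stdGaussPdf (t : ℝ) : HasDerivAt stdGaussPdf (-t * stdGaussPdf t) t := by
  unfold stdGaussPdf
  have h : HasDerivAt (fun t : ℝ => -(t ^ 2) / 2) (-t) t := by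
    refine ((hasDerivAt_pow 2 t).neg.div_const 2).congr_deriv ?_
    norm_num
    ring
  refine (h.exp.const_mul ((Real.sqrt (2 * Real.pi))⁻¹)).congr_deriv ?_
  ring

lemma hasDerivAt_stdGaussCdf (t : ℝ) : HasDerivAt stdGaussCdf (stdGaussPdf t) t := by
  have h : stdGaussCdf = fun t => stdGaussCdf 0 + ∫ s in (0 : ℝ)..t, stdGaussPdf s := by
    ext t
    have := intervalIntegral.integral_Iic_sub_Iic (a := (0 : ℝ)) (b := t)
      integrable_stdGaussPdf.integrableOn integrable_stdGaussPdf.integrableOn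
    rw [← this]
    simp [stdGaussCdf]
  rw [h]
  exact (intervalIntegral.integral_hasDerivAt_right
    (integrable_stdGaussPdf.intervalIntegrable)
    (continuous_stdGaussPdf.stronglyMeasurableAtFilter _ _)
    continuous_stdGaussPdf.continuousAt).const_add _

lemma one_sub_stdGaussCdf_neg (t : ℝ) : 1 - stdGaussCdf (-t) = stdGaussCdf t := by
  have h1 := integral_add_compl (measurableSet_Iic (a := -t)) integrable_stdGaussPdf
  rw [integral_stdGaussPdf] at h1
  have h2 : ∫ s in (Iic (-t))ᶜ, stdGaussPdf s = stdGaussCdf t := by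
    rw [compl_Iic, ← integral_comp_neg_Iic]
    simp [stdGaussPdf_neg, stdGaussCdf]
  rw [h2] at h1
  unfold stdGaussCdf at *
  linarith

lemma stdGaussCdf_le_one (t : ℝ) : stdGaussCdf t ≤ 1 := by
  rw [← integral_stdGaussPdf]
  exact setIntegral_le_integral integrable_stdGaussPdf
    (Eventually.of_forall fun s => (stdGaussPdf_pos s).le)

/-- A lower Mills-type bound for the Gaussian distribution function. -/
lemma stdGaussPdf_le_mul_stdGaussCdf (t : ℝ) :
    stdGaussPdf t ≤ Real.exp (3 / 2) * (1 + |t|) * stdGaussCdf t := by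
  set d : ℝ := (1 + |t|)⁻¹ with hd
  have hpos : 0 < 1 + |t| := by positivity
  have hd0 : 0 < d := by positivity
  have hd1 : d * (1 + |t|) = 1 := inv_mul_cancel₀ hpos.ne'
  have hdt : d * |t| ≤ 1 := by nlinarith
  have hdl : d ≤ 1 := by nlinarith [abs_nonneg t]
  have h1 : ∀ s ∈ Ioc (t - d) t, stdGaussPdf t * Real.exp (-(3 / 2)) ≤ stdGaussPdf s := by
    intro s hs
    unfold stdGaussPdf
    rw [mul_assoc, ← Real.exp_add]
    have hs1 : |s| ≤ |t| + d := by
      have : |s - t| ≤ d := by rw [abs_le]; constructor <;> linarith [hs.1, hs.2]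
      calc |s| = |t + (s - t)| := by ring_nf
        _ ≤ |t| + |s - t| := abs_add_le _ _
        _ ≤ _ := by gcongr
    have hs2 : s ^ 2 ≤ t ^ 2 + 3 := by
      rw [← sq_abs s, ← sq_abs t]
      have := pow_le_pow_left₀ (abs_nonneg s) hs1 2
      nlinarith
    gcongr
    linarith
  have h2 : stdGaussPdf t * Real.exp (-(3 / 2)) * d ≤ stdGaussCdf t := by
    calc stdGaussPdf t * Real.exp (-(3 / 2)) * d
        = ∫ s in Ioc (t - d) t, stdGaussPdf t * Real.exp (-(3 / 2)) := by
          simp [hd0.le]; ring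
      _ ≤ ∫ s in Ioc (t - d) t, stdGaussPdf s := by
          refine setIntegral_mono_on (integrableOn_const (by simp)) integrable_stdGaussPdf.integrableOn
            measurableSet_Ioc h1
      _ ≤ _ := by
          refine setIntegral_mono_set integrable_stdGaussPdf.integrableOn
            (Eventually.of_forall fun s => (stdGaussPdf_pos s).le) ?_
          exact (Ioc_subset_Iic_self).eventuallyLE
  have h3 : Real.exp (-(3 / 2)) * Real.exp (3 / 2) = 1 := by rw [← Real.exp_add]; simp
  calc stdGaussPdf t
      = Real.exp (3 / 2) * (1 + |t|) * (stdGaussPdf t * Real.exp (-(3 / 2)) * d) := by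
        linear_combination (-stdGaussPdf t) * h3 -
          stdGaussPdf t * (Real.exp (-(3 / 2)) * Real.exp (3 / 2)) * hd1
    _ ≤ _ := by gcongr

lemma stdGaussCdf_pos (t : ℝ) : 0 < stdGaussCdf t := by
  have h := (stdGaussPdf_pos t).trans_le (stdGaussPdf_le_mul_stdGaussCdf t)
  exact pos_of_mul_pos_right h (by positivity)

lemma stdGaussCdf_le_exp_mul {k : ℝ} (hk : 1 ≤ k) (t : ℝ) :
    stdGaussCdf t ≤ Real.exp (k ^ 2 / 2) * Real.exp (k * t) := by
  have h1 : ∀ s, stdGaussPdf s ≤ Real.exp (k ^ 2 / 2) * Real.exp (k * s) := by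
    intro s
    unfold stdGaussPdf
    rw [← Real.exp_add]
    have hc : (Real.sqrt (2 * Real.pi))⁻¹ ≤ 1 := by
      apply inv_le_one_of_one_le₀
      rw [Real.one_le_sqrt]
      nlinarith [Real.pi_gt_three]
    calc _ ≤ 1 * Real.exp (-(s ^ 2) / 2) := by gcongr
      _ ≤ _ := by
        rw [one_mul]
        gcongr
        nlinarith [sq_nonneg (k + s)]
  have hk0 : 0 < k := by linarith
  calc stdGaussCdf t ≤ ∫ s in Iic t, Real.exp (k ^ 2 / 2) * Real.exp (k * s) :=
        setIntegral_mono integrable_stdGaussPdf.integrableOn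
          ((integrableOn_exp_mul_Iic hk0 t).const_mul _) h1
    _ = Real.exp (k ^ 2 / 2) * (Real.exp (k * t) / k) := by
        rw [integral_const_mul, integral_exp_mul_Iic hk0]
    _ ≤ _ := by
        gcongr
        exact div_le_self (by positivity) hk

lemma contDiff_stdGaussCdf : ContDiff ℝ 2 stdGaussCdf := by
  have hd : deriv stdGaussCdf = stdGaussPdf := funext fun t => (hasDerivAt_stdGaussCdf t).deriv
  rw [show (2 : WithTop ℕ∞) = 1 + 1 by norm_num, contDiff_succ_iff_deriv]
  refine ⟨fun t => (hasDerivAt_stdGaussCdf t).differentiableAt, by simp, ?_⟩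
  rw [hd]
  exact contDiff_stdGaussPdf (n := 1)

lemma contDiff_log_stdGaussCdf : ContDiff ℝ 2 (fun t => Real.log (stdGaussCdf t)) :=
  contDiff_stdGaussCdf.log fun t => (stdGaussCdf_pos t).ne'

/-- Twice continuously differentiable functions whose derivatives up to order two are
polynomially bounded. -/
def HasPolyGrowthTwo {E F : Type*} [NormedAddCommGroup E] [NormedSpace ℝ E]
    [NormedAddCommGroup F] [NormedSpace ℝ F] (f : E → F) : Prop :=
  ContDiff ℝ 2 f ∧ ∃ (k : ℕ) (C : ℝ), 0 ≤ C ∧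
    ∀ n ≤ 2, ∀ x, ‖iteratedFDeriv ℝ n f x‖ ≤ C * (1 + ‖x‖) ^ k

namespace HasPolyGrowthTwo

variable {E F G : Type*} [NormedAddCommGroup E] [NormedSpace ℝ E]
  [NormedAddCommGroup F] [NormedSpace ℝ F] [NormedAddCommGroup G] [NormedSpace ℝ G]

lemma of_hasTemperateGrowth {f : E → F} (hf : f.HasTemperateGrowth) : HasPolyGrowthTwo f := by
  obtain ⟨k, C, hC, h⟩ := hf.norm_iteratedFDeriv_le_uniform 2
  exact ⟨contDiff_infty.1 hf.1 2, k, C, hC, h⟩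

lemma add {f g : E → F} (hf : HasPolyGrowthTwo f) (hg : HasPolyGrowthTwo g) :
    HasPolyGrowthTwo (fun x => f x + g x) := by
  obtain ⟨hf0, k, C, hC, h⟩ := hf
  obtain ⟨hg0, k', C', hC', h'⟩ := hg
  refine ⟨hf0.add hg0, k + k', C + C', by positivity, fun n hn x => ?_⟩
  have hn' : (n : WithTop ℕ∞) ≤ 2 := by exact_mod_cast hn
  have h1 : (1 : ℝ) ≤ 1 + ‖x‖ := by simp
  rw [fun_iteratedFDeriv_add (hf0.of_le hn') (hg0.of_le hn')]
  calc _ ≤ _ := norm_add_le _ _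
    _ ≤ C * (1 + ‖x‖) ^ k + C' * (1 + ‖x‖) ^ k' := add_le_add (h n hn x) (h' n hn x)
    _ ≤ C * (1 + ‖x‖) ^ (k + k') + C' * (1 + ‖x‖) ^ (k + k') := by
      gcongr <;> first | exact h1 | omega
    _ = _ := by ring

lemma comp {g : F → G} {f : E → F} (hg : HasPolyGrowthTwo g) (hf : HasPolyGrowthTwo f) :
    HasPolyGrowthTwo (g ∘ f) := by
  obtain ⟨hf0, k, C, hC, h⟩ := hf
  obtain ⟨hg0, k', C', hC', h'⟩ := hg
  refine ⟨hg0.comp hf0, k * k' + k * 2, 2 * (C' * (1 + C) ^ k') * (1 + C) ^ 2, by positivity,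
    fun n hn x => ?_⟩
  have hn' : (n : WithTop ℕ∞) ≤ 2 := by exact_mod_cast hn
  have hx : 1 ≤ (1 + ‖x‖) ^ k := one_le_pow₀ (by simp)
  have hD : 1 ≤ (1 + C) * (1 + ‖x‖) ^ k := one_le_mul_of_one_le_of_one_le (by simpa) hx
  have hfx : 1 + ‖f x‖ ≤ (1 + C) * (1 + ‖x‖) ^ k := by
    have := h 0 (by norm_num) x
    rw [norm_iteratedFDeriv_zero] at this
    linarith
  have key := norm_iteratedFDeriv_comp_le (𝕜 := ℝ) hg0 hf0 hn' x
    (C := C' * ((1 + C) * (1 + ‖x‖) ^ k) ^ k') (D := (1 + C) * (1 + ‖x‖) ^ k)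
    (fun i hi => (h' i (hi.trans hn) _).trans (by gcongr))
    (fun i hi hi' => (h i (hi'.trans hn) x).trans
      (le_trans (by nlinarith) (le_self_pow₀ hD (by omega))))
  have hfac : (n.factorial : ℝ) ≤ 2 := by exact_mod_cast Nat.factorial_le hn
  calc _ ≤ _ := key
    _ ≤ 2 * (C' * ((1 + C) * (1 + ‖x‖) ^ k) ^ k') * ((1 + C) * (1 + ‖x‖) ^ k) ^ 2 := by
      gcongr
    _ = _ := by rw [pow_add, pow_mul, pow_mul, mul_pow _ _ k', mul_pow _ _ 2]; ring

lemma exp_const_mul {f : E → ℝ} (hf : HasPolyGrowthTwo f) {r : ℝ} (hr : 0 ≤ r) :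
    ∃ (k : ℕ) (C : ℝ), 0 ≤ C ∧ ∀ n ≤ 2, ∀ x,
      ‖iteratedFDeriv ℝ n (fun x => Real.exp (r * f x)) x‖
        ≤ C * (1 + ‖x‖) ^ k * Real.exp (r * f x) := by
  obtain ⟨hf0, k, C, hC, h⟩ := hf
  refine ⟨k * 2, 2 * (1 + r) ^ 2 * (1 + C) ^ 2, by positivity, fun n hn x => ?_⟩
  have hn' : (n : WithTop ℕ∞) ≤ 2 := by exact_mod_cast hn
  have hx : 1 ≤ (1 + ‖x‖) ^ k := one_le_pow₀ (by simp)
  have hD : 1 ≤ (1 + C) * (1 + ‖x‖) ^ k := one_le_mul_of_one_le_of_one_le (by simpa) hx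
  have hg0 : ContDiff ℝ 2 (fun u : ℝ => Real.exp (r * u)) := by fun_prop
  have key := norm_iteratedFDeriv_comp_le (𝕜 := ℝ) hg0 hf0 hn' x
    (C := (1 + r) ^ 2 * Real.exp (r * f x)) (D := (1 + C) * (1 + ‖x‖) ^ k)
    (fun i hi => by
      rw [norm_iteratedFDeriv_eq_norm_iteratedDeriv, iteratedDeriv_exp_const_mul, norm_mul,
        norm_pow, Real.norm_of_nonneg hr, Real.norm_of_nonneg (Real.exp_pos _).le]
      gcongr ?_ * _
      calc r ^ i ≤ (1 + r) ^ i := by gcongr; linarith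
        _ ≤ _ := pow_le_pow_right₀ (by linarith) (by omega))
    (fun i hi hi' => (h i (hi'.trans hn) x).trans
      (le_trans (by nlinarith) (le_self_pow₀ hD (by omega))))
  have hfac : (n.factorial : ℝ) ≤ 2 := by exact_mod_cast Nat.factorial_le hn
  calc _ ≤ _ := key
    _ ≤ 2 * ((1 + r) ^ 2 * Real.exp (r * f x)) * ((1 + C) * (1 + ‖x‖) ^ k) ^ 2 := by
      gcongr
    _ = _ := by rw [pow_mul]; ring

end HasPolyGrowthTwo

lemma hasPolyGrowthTwo_log_stdGaussCdf :
    HasPolyGrowthTwo (fun t => Real.log (stdGaussCdf t)) := by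
  set K : ℝ := Real.exp (3 / 2) with hK
  have hK1 : 1 ≤ K := Real.one_le_exp (by norm_num)
  set m : ℝ → ℝ := fun t => stdGaussPdf t / stdGaussCdf t with hm
  have hm0 : ∀ t, 0 ≤ m t := fun t => (div_pos (stdGaussPdf_pos t) (stdGaussCdf_pos t)).le
  have hm1 : ∀ t, m t ≤ K * (1 + |t|) := fun t =>
    (div_le_iff₀ (stdGaussCdf_pos t)).2 (stdGaussPdf_le_mul_stdGaussCdf t)
  have hd1 : deriv (fun t => Real.log (stdGaussCdf t)) = m := funext fun t =>
    ((hasDerivAt_stdGaussCdf t).log (stdGaussCdf_pos t).ne').deriv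
  have hd2 : ∀ t, deriv m t = - m t * (t + m t) := by
    intro t
    have hne := (stdGaussCdf_pos t).ne'
    refine (((hasDerivAt_stdGaussPdf t).div (hasDerivAt_stdGaussCdf t) hne).congr_deriv ?_).deriv
    simp only [hm]
    field_simp
    ring
  set c : ℝ := Real.log (Real.sqrt (2 * Real.pi)) with hc
  have hs : 0 < Real.sqrt (2 * Real.pi) := by positivity
  have hlog : ∀ t, |Real.log (stdGaussCdf t)| ≤ (3 + |c|) * (1 + |t|) ^ 2 := by
    intro t
    have ht : 0 < 1 + |t| := by positivity
    have h0 : Real.log (stdGaussCdf t) ≤ 0 :=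
      Real.log_nonpos (stdGaussCdf_pos t).le (stdGaussCdf_le_one t)
    have h1 := Real.log_le_log (stdGaussPdf_pos t) (stdGaussPdf_le_mul_stdGaussCdf t)
    rw [Real.log_mul (by positivity) (stdGaussCdf_pos t).ne', Real.log_mul (by positivity) ht.ne',
      Real.log_exp, stdGaussPdf, Real.log_mul (by positivity) (by positivity), Real.log_exp,
      Real.log_inv] at h1
    have h2 : Real.log (1 + |t|) ≤ |t| := by linarith [Real.log_le_sub_one_of_pos ht]
    rw [abs_of_nonpos h0]
    have h3 := le_abs_self c
    have h4 := abs_nonneg t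
    have h5 := sq_abs t
    nlinarith [mul_nonneg (abs_nonneg c) h4, mul_nonneg (abs_nonneg c) (sq_nonneg |t|)]
  refine ⟨contDiff_log_stdGaussCdf, 2, K * (1 + K) + (3 + |c|), by positivity, fun n hn t => ?_⟩
  have hone : 1 ≤ 1 + |t| := by simp
  have hnn : 0 ≤ |c| := abs_nonneg c
  have hsq : 1 + |t| ≤ (1 + |t|) ^ 2 := le_self_pow₀ hone (by norm_num)
  have hsq0 : 0 ≤ (1 + |t|) ^ 2 := by positivity
  rw [norm_iteratedFDeriv_eq_norm_iteratedDeriv, Real.norm_eq_abs, Real.norm_eq_abs]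
  interval_cases n
  · rw [iteratedDeriv_zero]
    nlinarith [hlog t, mul_nonneg (by positivity : 0 ≤ K * (1 + K)) hsq0]
  · rw [iteratedDeriv_one, hd1, abs_of_nonneg (hm0 t)]
    calc m t ≤ K * (1 + |t|) ^ 2 := (hm1 t).trans (by gcongr)
      _ ≤ _ := by gcongr; nlinarith
  · rw [iteratedDeriv_succ, iteratedDeriv_one, hd1, hd2, abs_mul, abs_neg, abs_of_nonneg (hm0 t)]
    calc m t * |t + m t| ≤ (K * (1 + |t|)) * ((1 + |t|) + K * (1 + |t|)) := by
          gcongr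
          · exact hm1 t
          · refine (abs_add_le _ _).trans (add_le_add (by simp) ?_)
            rw [abs_of_nonneg (hm0 t)]
            exact hm1 t
      _ = K * (1 + K) * (1 + |t|) ^ 2 := by ring
      _ ≤ _ := by gcongr; linarith

/-- The logarithm of a Gaussian-type kernel times a Gaussian distribution function, in the
variable `v.1` with coefficients `v.2`. Both pseudo conditional densities are of this form. -/
noncomputable def logKernel (v : ℝ × (Fin 5 → ℝ)) : ℝ :=
  v.2 0 + v.2 1 * v.1 - v.2 2 ^ 2 * v.1 ^ 2 + Real.log (stdGaussCdf (v.2 3 + v.2 4 * v.1))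

lemma hasPolyGrowthTwo_logKernel : HasPolyGrowthTwo logKernel := by
  have hp : ∀ i, Function.HasTemperateGrowth (fun v : ℝ × (Fin 5 → ℝ) => v.2 i) := fun i =>
    ((ContinuousLinearMap.proj (R := ℝ) (φ := fun _ : Fin 5 => ℝ) i).comp
      (ContinuousLinearMap.snd ℝ ℝ (Fin 5 → ℝ))).hasTemperateGrowth
  have hz : Function.HasTemperateGrowth (fun v : ℝ × (Fin 5 → ℝ) => v.1) :=
    (ContinuousLinearMap.fst ℝ ℝ (Fin 5 → ℝ)).hasTemperateGrowth
  refine HasPolyGrowthTwo.add (.of_hasTemperateGrowth ?_)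
    (hasPolyGrowthTwo_log_stdGaussCdf.comp (f := fun v : ℝ × (Fin 5 → ℝ) => v.2 3 + v.2 4 * v.1)
      (.of_hasTemperateGrowth ?_))
  · exact ((hp 0).add ((hp 1).mul hz)).sub (((hp 2).pow 2).mul (hz.pow 2))
  · exact (hp 3).add ((hp 4).mul hz)

lemma exists_one_add_pow_mul_exp_le (k : ℕ) {e : ℝ} (he : 0 < e) :
    ∃ C : ℝ, 0 ≤ C ∧ ∀ z : ℝ, (1 + |z|) ^ k * Real.exp (-(e * |z|)) ≤ C * (1 + z ^ 2)⁻¹ := by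
  refine ⟨(k + 2).factorial * (e⁻¹) ^ (k + 2) * Real.exp e, by positivity, fun z => ?_⟩
  have h1 := Real.pow_div_factorial_le_exp (e * (1 + |z|)) (by positivity) (k + 2)
  rw [div_le_iff₀ (by positivity), mul_pow] at h1
  have h2 : 1 + z ^ 2 ≤ (1 + |z|) ^ 2 := by nlinarith [abs_nonneg z, sq_abs z]
  rw [← div_eq_mul_inv, le_div_iff₀ (by positivity)]
  calc (1 + |z|) ^ k * Real.exp (-(e * |z|)) * (1 + z ^ 2)
      ≤ (1 + |z|) ^ k * Real.exp (-(e * |z|)) * (1 + |z|) ^ 2 := by gcongr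
    _ = (e⁻¹) ^ (k + 2) * Real.exp (-(e * |z|)) * (e ^ (k + 2) * (1 + |z|) ^ (k + 2)) := by
        rw [inv_pow, pow_add (1 + |z|)]
        field_simp
    _ ≤ (e⁻¹) ^ (k + 2) * Real.exp (-(e * |z|)) *
          (Real.exp (e * (1 + |z|)) * (k + 2).factorial) := by gcongr
    _ = (k + 2).factorial * (e⁻¹) ^ (k + 2) *
          Real.exp (-(e * |z|) + e * (1 + |z|)) := by rw [Real.exp_add]; ring
    _ = _ := by ring_nf

section LocallyDominated

variable {V G : Type*} [NormedAddCommGroup V] [NormedAddCommGroup G]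

/-- `L (z, c)` tends to `-∞` at least linearly in `|z|`, locally uniformly in the parameter. -/
def LocallyDecays (L : ℝ × V → ℝ) (c : V) : Prop :=
  ∃ C e : ℝ, 0 < e ∧ ∀ᶠ c' in 𝓝 c, ∀ z, L (z, c') ≤ C - e * |z|

/-- `h` is bounded by an integrable function of `z`, locally uniformly in the parameter. -/
def LocallyDominated (h : ℝ × V → G) (c : V) : Prop :=
  ∃ M : ℝ, ∀ᶠ c' in 𝓝 c, ∀ z, ‖h (z, c')‖ ≤ M * (1 + z ^ 2)⁻¹

lemma LocallyDominated.congr_norm {G' : Type*} [NormedAddCommGroup G']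
    {h : ℝ × V → G} {h' : ℝ × V → G'} {c : V}
    (hh : LocallyDominated h c) (hle : ∀ v, ‖h' v‖ ≤ ‖h v‖) : LocallyDominated h' c := by
  obtain ⟨M, hM⟩ := hh
  exact ⟨M, hM.mono fun c' hc' z => (hle _).trans (hc' z)⟩

lemma LocallyDominated.eventually_norm_integral_le [NormedSpace ℝ G] {h : ℝ × V → G} {c : V}
    (hh : LocallyDominated h c) : ∃ M : ℝ, ∀ᶠ c' in 𝓝 c, ‖∫ z, h (z, c')‖ ≤ M := by
  obtain ⟨M, hM⟩ := hh
  exact ⟨∫ z, M * (1 + z ^ 2)⁻¹, hM.mono fun c' hc' =>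
    norm_integral_le_of_norm_le (integrable_inv_one_add_sq.const_mul M) (Eventually.of_forall hc')⟩

end LocallyDominated

section ParametricIntegral

variable {V G : Type*} [NormedAddCommGroup V] [NormedSpace ℝ V]
  [NormedAddCommGroup G] [NormedSpace ℝ G]

lemma LocallyDecays.iteratedFDeriv_exp {L : ℝ × V → ℝ} {c : V} (hd : LocallyDecays L c)
    (hL : HasPolyGrowthTwo L) {r : ℝ} (hr : 0 < r) {n : ℕ} (hn : n ≤ 2) :
    LocallyDominated (iteratedFDeriv ℝ n (fun v => Real.exp (r * L v))) c := by
  obtain ⟨C, e, he, hd⟩ := hd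
  obtain ⟨k, A, hA, hb⟩ := hL.exp_const_mul hr.le
  obtain ⟨B, hB, hz⟩ := exists_one_add_pow_mul_exp_le k (mul_pos hr he)
  have hc : ∀ᶠ c' in 𝓝 c, ‖c'‖ < ‖c‖ + 1 :=
    continuous_norm.continuousAt.eventually_lt continuousAt_const (by linarith)
  refine ⟨A * (2 + ‖c‖) ^ k * Real.exp (r * C) * B, ?_⟩
  filter_upwards [hd, hc] with c' hd' hc' z
  have h1 : 1 + ‖(z, c')‖ ≤ (2 + ‖c‖) * (1 + |z|) := by
    have : ‖(z, c')‖ ≤ |z| + ‖c'‖ := by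
      rw [Prod.norm_def, Real.norm_eq_abs]
      exact max_le_add_of_nonneg (abs_nonneg _) (norm_nonneg _)
    nlinarith [abs_nonneg z, norm_nonneg c]
  have h2 : Real.exp (r * L (z, c')) ≤ Real.exp (r * C) * Real.exp (-(r * e * |z|)) := by
    rw [← Real.exp_add]
    gcongr
    nlinarith [hd' z]
  calc _ ≤ _ := hb n hn (z, c')
    _ ≤ A * ((2 + ‖c‖) * (1 + |z|)) ^ k * (Real.exp (r * C) * Real.exp (-(r * e * |z|))) := by
      gcongr
    _ = A * (2 + ‖c‖) ^ k * Real.exp (r * C) * ((1 + |z|) ^ k * Real.exp (-(r * e * |z|))) := by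
      rw [mul_pow]; ring
    _ ≤ A * (2 + ‖c‖) ^ k * Real.exp (r * C) * (B * (1 + z ^ 2)⁻¹) :=
      mul_le_mul_of_nonneg_left (hz z) (by positivity)
    _ = _ := by ring

/-- Derivative in the parameter direction. -/
noncomputable def paramDeriv (h : ℝ × V → G) (v : ℝ × V) : V →L[ℝ] G :=
  (fderiv ℝ h v).comp (ContinuousLinearMap.inr ℝ ℝ V)

lemma norm_paramDeriv_le (h : ℝ × V → G) (v : ℝ × V) : ‖paramDeriv h v‖ ≤ ‖fderiv ℝ h v‖ := by
  refine (ContinuousLinearMap.opNorm_comp_le _ _).trans ?_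
  exact mul_le_of_le_one_right (norm_nonneg _) (ContinuousLinearMap.norm_inr_le_one ℝ ℝ V)

lemma ContDiff.paramDeriv {h : ℝ × V → G} {n : WithTop ℕ∞} (hh : ContDiff ℝ (n + 1) h) :
    ContDiff ℝ n (paramDeriv h) :=
  (hh.fderiv_right le_rfl).clm_comp contDiff_const

lemma norm_fderiv_paramDeriv_le {h : ℝ × V → G} (hh : ContDiff ℝ 2 h) (v : ℝ × V) :
    ‖fderiv ℝ (paramDeriv h) v‖ ≤ ‖fderiv ℝ (fderiv ℝ h) v‖ := by
  have hd : DifferentiableAt ℝ (fderiv ℝ h) v :=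
    ((hh.fderiv_right (m := 1) (by norm_num)).differentiable (by norm_num)).differentiableAt
  set Λ : ((ℝ × V) →L[ℝ] G) →L[ℝ] (V →L[ℝ] G) :=
    (ContinuousLinearMap.compL ℝ V (ℝ × V) G).flip (ContinuousLinearMap.inr ℝ ℝ V) with hΛ
  have hΛn : ‖Λ‖ ≤ 1 := by
    refine ContinuousLinearMap.opNorm_le_bound _ zero_le_one fun u => ?_
    rw [one_mul]
    refine (ContinuousLinearMap.opNorm_comp_le _ _).trans ?_
    exact mul_le_of_le_one_right (norm_nonneg _) (ContinuousLinearMap.norm_inr_le_one ℝ ℝ V)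
  have : fderiv ℝ (_root_.paramDeriv h) v = Λ.comp (fderiv ℝ (fderiv ℝ h) v) :=
    (Λ.hasFDerivAt.comp v hd.hasFDerivAt).fderiv
  rw [this]
  refine (ContinuousLinearMap.opNorm_comp_le _ _).trans ?_
  exact mul_le_of_le_one_left (norm_nonneg _) hΛn

lemma LocallyDominated.eventually_hasFDerivAt_integral {h : ℝ × V → G} {c : V}
    (hh : LocallyDominated h c) (hh' : LocallyDominated (fderiv ℝ h) c) (hc : ContDiff ℝ 1 h) :
    ∀ᶠ c' in 𝓝 c, HasFDerivAt (fun c => ∫ z, h (z, c)) (∫ z, paramDeriv h (z, c')) c' := by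
  obtain ⟨M, hM⟩ := hh
  obtain ⟨M', hM'⟩ := hh'
  have hcont : ∀ c' : V, Continuous fun z : ℝ => h (z, c') := fun c' =>
    hc.continuous.comp (by fun_prop)
  have hcont' : ∀ c' : V, Continuous fun z : ℝ => paramDeriv h (z, c') := fun c' =>
    (ContDiff.paramDeriv (n := 0) (by simpa using hc)).continuous.comp (by fun_prop)
  filter_upwards [hM, hM'.eventually_nhds] with c' h1 h2
  refine hasFDerivAt_integral_of_dominated_of_fderiv_le (F := fun c z => h (z, c))
    (F' := fun c z => paramDeriv h (z, c)) (bound := fun z => M' * (1 + z ^ 2)⁻¹) h2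
    (Eventually.of_forall fun c' => (hcont c').aestronglyMeasurable)
    ((integrable_inv_one_add_sq.const_mul M).mono' (hcont c').aestronglyMeasurable
      (Eventually.of_forall h1))
    (hcont' c').aestronglyMeasurable
    (Eventually.of_forall fun z x hx => (norm_paramDeriv_le h _).trans (hx z))
    (integrable_inv_one_add_sq.const_mul M')
    (Eventually.of_forall fun z x _ => ?_)
  exact ((hc.differentiable (by norm_num)).differentiableAt.hasFDerivAt).comp x
    (hasFDerivAt_prodMk_right z x)

end ParametricIntegral

/-- `f` is differentiable near `x` and twice differentiable at `x`, with first and second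
derivatives at `x` bounded by `A` and `B`. -/
structure HasTwoDerivBounds {E F : Type*} [NormedAddCommGroup E] [NormedSpace ℝ E]
    [NormedAddCommGroup F] [NormedSpace ℝ F] (f : E → F) (x : E) (A B : ℝ) : Prop where
  eventually_differentiableAt : ∀ᶠ y in 𝓝 x, DifferentiableAt ℝ f y
  differentiableAt_fderiv : DifferentiableAt ℝ (fderiv ℝ f) x
  norm_fderiv_le : ‖fderiv ℝ f x‖ ≤ A
  norm_fderiv_fderiv_le : ‖fderiv ℝ (fderiv ℝ f) x‖ ≤ B

namespace HasTwoDerivBounds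

variable {E F G : Type*} [NormedAddCommGroup E] [NormedSpace ℝ E]
  [NormedAddCommGroup F] [NormedSpace ℝ F] [NormedAddCommGroup G] [NormedSpace ℝ G]

lemma mono {f : E → F} {x : E} {A B A' B' : ℝ} (h : HasTwoDerivBounds f x A B)
    (hA : A ≤ A') (hB : B ≤ B') : HasTwoDerivBounds f x A' B' :=
  ⟨h.1, h.2, h.3.trans hA, h.4.trans hB⟩

lemma congr {f g : E → F} {x : E} {A B : ℝ} (h : HasTwoDerivBounds f x A B)
    (hfg : f =ᶠ[𝓝 x] g) : HasTwoDerivBounds g x A B := by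
  refine ⟨?_, ?_, ?_, ?_⟩
  · filter_upwards [h.1, hfg.eventuallyEq_nhds] with y hy hy'
    exact hy.congr_of_eventuallyEq hy'.symm
  · exact h.2.congr_of_eventuallyEq hfg.symm.fderiv
  · rw [hfg.symm.fderiv_eq]; exact h.3
  · rw [hfg.symm.fderiv.fderiv_eq]; exact h.4

lemma of_contDiffAt {f : E → F} {x : E} (h : ContDiffAt ℝ 2 f x) :
    HasTwoDerivBounds f x ‖fderiv ℝ f x‖ ‖fderiv ℝ (fderiv ℝ f) x‖ :=
  ⟨(h.eventually (by simp)).mono fun _ hy => hy.differentiableAt (by norm_num),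
    (h.fderiv_right (m := 1) (by norm_num)).differentiableAt (by norm_num), le_rfl, le_rfl⟩

lemma of_clm (L : E →L[ℝ] F) (x : E) (hL : ‖L‖ ≤ 1) : HasTwoDerivBounds L x 1 0 :=
  (of_contDiffAt L.contDiff.contDiffAt).mono (by simpa using hL)
    (by rw [show fderiv ℝ L = fun _ => L from funext fun x => L.fderiv,
      fderiv_const_apply]; exact ContinuousLinearMap.opNorm_zero.le)

lemma add {f g : E → F} {x : E} {A B A' B' : ℝ} (hf : HasTwoDerivBounds f x A B)
    (hg : HasTwoDerivBounds g x A' B') :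
    HasTwoDerivBounds (fun y => f y + g y) x (A + A') (B + B') := by
  have h1 : fderiv ℝ (fun y => f y + g y) =ᶠ[𝓝 x] fun y => fderiv ℝ f y + fderiv ℝ g y := by
    filter_upwards [hf.1, hg.1] with y hy hy'
    exact fderiv_fun_add hy hy'
  refine ⟨?_, (hf.2.add hg.2).congr_of_eventuallyEq h1, ?_, ?_⟩
  · filter_upwards [hf.1, hg.1] with y hy hy'
    exact hy.add hy'
  · rw [h1.eq_of_nhds]
    exact (norm_add_le _ _).trans (add_le_add hf.3 hg.3)
  · rw [h1.fderiv_eq, fderiv_fun_add hf.2 hg.2]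
    have := norm_add_le (fderiv ℝ (fderiv ℝ f) x) (fderiv ℝ (fderiv ℝ g) x)
    exact this.trans (add_le_add hf.4 hg.4)

lemma comp {g : F → G} {f : E → F} {x : E} {A B A' B' : ℝ}
    (hg : HasTwoDerivBounds g (f x) A B) (hf : HasTwoDerivBounds f x A' B') :
    HasTwoDerivBounds (fun y => g (f y)) x (A * A') (B * A' ^ 2 + A * B') := by
  have hA : 0 ≤ A := (norm_nonneg _).trans hg.3
  have hB : 0 ≤ B := (norm_nonneg (fderiv ℝ (fderiv ℝ g) (f x))).trans hg.4
  have hA' : 0 ≤ A' := (norm_nonneg _).trans hf.3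
  have hfc : ContinuousAt f x := hf.1.self_of_nhds.continuousAt
  have hev := hfc.eventually hg.1
  have h1 : fderiv ℝ (fun y => g (f y)) =ᶠ[𝓝 x]
      fun y => (fderiv ℝ g (f y)).comp (fderiv ℝ f y) := by
    filter_upwards [hf.1, hev] with y hy hy'
    exact fderiv_fun_comp y hy' hy
  have hgf : HasFDerivAt (fun y => fderiv ℝ g (f y))
      ((fderiv ℝ (fderiv ℝ g) (f x)).comp (fderiv ℝ f x)) x :=
    hg.2.hasFDerivAt.comp x hf.1.self_of_nhds.hasFDerivAt
  have h2 := hgf.clm_comp hf.2.hasFDerivAt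
  refine ⟨?_, h2.differentiableAt.congr_of_eventuallyEq h1, ?_, ?_⟩
  · filter_upwards [hf.1, hev] with y hy hy'
    exact hy'.comp y hy
  · rw [h1.eq_of_nhds]
    exact (ContinuousLinearMap.opNorm_comp_le _ _).trans (mul_le_mul hg.3 hf.3 (norm_nonneg _) hA)
  · rw [h1.fderiv_eq, h2.fderiv, add_comm]
    refine (ContinuousLinearMap.opNorm_add_le _ _).trans (add_le_add ?_ ?_)
    · refine ContinuousLinearMap.opNorm_le_bound _ (by positivity) fun v => ?_
      refine (ContinuousLinearMap.opNorm_comp_le _ _).trans ?_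
      have h3 : ‖((fderiv ℝ (fderiv ℝ g) (f x)).comp (fderiv ℝ f x)) v‖ ≤ B * (A' * ‖v‖) :=
        (ContinuousLinearMap.le_of_opNorm_le (fderiv ℝ (fderiv ℝ g) (f x)) hg.4 _).trans
          (mul_le_mul_of_nonneg_left (ContinuousLinearMap.le_of_opNorm_le _ hf.3 _) hB)
      calc _ ≤ (B * (A' * ‖v‖)) * A' := mul_le_mul h3 hf.3 (norm_nonneg _) (by positivity)
        _ = _ := by ring
    · refine ContinuousLinearMap.opNorm_le_bound _
        (mul_nonneg hA ((norm_nonneg (fderiv ℝ (fderiv ℝ f) x)).trans hf.4)) fun v => ?_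
      refine (ContinuousLinearMap.opNorm_comp_le _ _).trans ?_
      rw [mul_assoc]
      exact mul_le_mul hg.3 (ContinuousLinearMap.le_of_opNorm_le (fderiv ℝ (fderiv ℝ f) x) hf.4 _) (norm_nonneg _) hA

end HasTwoDerivBounds

section Objective

variable {V : Type*} [NormedAddCommGroup V] [NormedSpace ℝ V]

lemma LocallyDecays.exists_hasTwoDerivBounds_integral {L : ℝ × V → ℝ} {c : V}
    (hd : LocallyDecays L c) (hL : HasPolyGrowthTwo L) {r : ℝ} (hr : 0 < r) :
    ∃ M : ℝ, ∀ᶠ c' in 𝓝 c,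
      HasTwoDerivBounds (fun c => ∫ z, Real.exp (r * L (z, c))) c' M M := by
  set h : ℝ × V → ℝ := fun v => Real.exp (r * L v) with hh
  have hC : ContDiff ℝ 2 h := (contDiff_const.mul hL.1).exp
  have h0 : LocallyDominated h c :=
    (hd.iteratedFDeriv_exp hL hr (n := 0) (by norm_num)).congr_norm fun v => by
      rw [norm_iteratedFDeriv_zero]
  have h1 : LocallyDominated (fderiv ℝ h) c :=
    (hd.iteratedFDeriv_exp hL hr (n := 1) (by norm_num)).congr_norm fun v => by
      rw [norm_iteratedFDeriv_one]
  have h2 : LocallyDominated (fderiv ℝ (fderiv ℝ h)) c :=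
    (hd.iteratedFDeriv_exp hL hr (n := 2) (by norm_num)).congr_norm fun v => by
      rw [← norm_iteratedFDeriv_one, norm_iteratedFDeriv_fderiv]
  have h1' : LocallyDominated (paramDeriv h) c := h1.congr_norm (norm_paramDeriv_le h)
  have h2' : LocallyDominated (fderiv ℝ (paramDeriv h)) c :=
    h2.congr_norm (norm_fderiv_paramDeriv_le hC)
  have h2'' : LocallyDominated (paramDeriv (paramDeriv h)) c :=
    h2'.congr_norm (norm_paramDeriv_le _)
  have hC1 : ContDiff ℝ 1 (paramDeriv h) := ContDiff.paramDeriv (by simpa [one_add_one_eq_two])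
  obtain ⟨M1, hM1⟩ := h1'.eventually_norm_integral_le
  obtain ⟨M2, hM2⟩ := h2''.eventually_norm_integral_le
  refine ⟨max M1 M2, ?_⟩
  filter_upwards [(h0.eventually_hasFDerivAt_integral h1
    (hC.of_le (by norm_num))).eventually_nhds,
    h1'.eventually_hasFDerivAt_integral h2' hC1, hM1, hM2] with c' e1 e2 b1 b2
  have e3 : fderiv ℝ (fun c => ∫ z, h (z, c)) =ᶠ[𝓝 c'] fun c => ∫ z, paramDeriv h (z, c) :=
    e1.mono fun c hc => hc.fderiv
  refine ⟨e1.mono fun c hc => hc.differentiableAt,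
    e2.differentiableAt.congr_of_eventuallyEq e3, ?_, ?_⟩
  · rw [e3.eq_of_nhds]
    exact b1.trans (le_max_left _ _)
  · rw [e3.fderiv_eq, e2.fderiv]
    exact b2.trans (le_max_right _ _)

lemma LocallyDecays.exists_hasTwoDerivBounds_exp {L : ℝ × V → ℝ} {c : V}
    (hd : LocallyDecays L c) (hL : HasPolyGrowthTwo L) {r : ℝ} (hr : 0 < r) :
    ∃ M : ℝ, ∀ᶠ c' in 𝓝 c, ∀ z : ℝ,
      HasTwoDerivBounds (fun v => Real.exp (r * L v)) (z, c') M M := by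
  have hC : ContDiff ℝ 2 (fun v => Real.exp (r * L v)) := (contDiff_const.mul hL.1).exp
  obtain ⟨M1, h1⟩ := hd.iteratedFDeriv_exp hL hr (n := 1) (by norm_num)
  obtain ⟨M2, h2⟩ := hd.iteratedFDeriv_exp hL hr (n := 2) (by norm_num)
  have hz : ∀ M z : ℝ, M * (1 + z ^ 2)⁻¹ ≤ |M| := fun M z => by
    have h3 : (1 + z ^ 2)⁻¹ ≤ 1 := inv_le_one_of_one_le₀ (by nlinarith [sq_nonneg z])
    calc M * (1 + z ^ 2)⁻¹ ≤ |M| * (1 + z ^ 2)⁻¹ := by gcongr; exact le_abs_self M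
      _ ≤ |M| * 1 := by gcongr
      _ = |M| := mul_one _
  refine ⟨max |M1| |M2|, ?_⟩
  filter_upwards [h1, h2] with c' b1 b2 z
  refine (HasTwoDerivBounds.of_contDiffAt hC.contDiffAt).mono ?_ ?_
  · rw [← norm_iteratedFDeriv_one]
    exact ((b1 z).trans (hz _ _)).trans (le_max_left _ _)
  · rw [← norm_iteratedFDeriv_one, norm_iteratedFDeriv_fderiv]
    exact ((b2 z).trans (hz _ _)).trans (le_max_right _ _)

/-- The objective function of the density `exp ∘ L`, as a function of the residual and the
coefficients. -/
noncomputable def residualObjective (a : ℝ) (L : ℝ × V → ℝ) (v : ℝ × V) : ℝ :=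
  (∫ z, Real.exp ((1 + a) * L (z, v.2))) + -(1 + 1 / a) * Real.exp (a * L v)

lemma exists_hasTwoDerivBounds_residualObjective {L : ℝ × V → ℝ} (hL : HasPolyGrowthTwo L)
    {a : ℝ} (ha : 0 < a) {K : Set V} (hK : IsCompact K) (hd : ∀ c ∈ K, LocallyDecays L c) :
    ∃ M : ℝ, 0 ≤ M ∧ ∀ c ∈ K, ∀ z : ℝ,
      HasTwoDerivBounds (residualObjective a L) (z, c) M M := by
  refine hK.induction_on (p := fun S => ∃ M : ℝ, 0 ≤ M ∧ ∀ c ∈ S, ∀ z : ℝ,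
    HasTwoDerivBounds (residualObjective a L) (z, c) M M) ⟨0, le_rfl, by simp⟩ ?_ ?_ ?_
  · rintro s t hst ⟨M, hM, h⟩
    exact ⟨M, hM, fun c hc => h c (hst hc)⟩
  · rintro s t ⟨M, hM, h⟩ ⟨M', hM', h'⟩
    refine ⟨max M M', hM.trans (le_max_left _ _), ?_⟩
    rintro c (hc | hc) z
    · exact (h c hc z).mono (le_max_left _ _) (le_max_left _ _)
    · exact (h' c hc z).mono (le_max_right _ _) (le_max_right _ _)
  · intro c hc
    obtain ⟨M1, h1⟩ := (hd c hc).exists_hasTwoDerivBounds_integral hL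
      (show 0 < 1 + a by linarith)
    obtain ⟨M2, h2⟩ := (hd c hc).exists_hasTwoDerivBounds_exp hL ha
    have hev : ∀ᶠ c' in 𝓝 c, ∀ z : ℝ, HasTwoDerivBounds (residualObjective a L) (z, c')
        (M1 + (1 + 1 / a) * M2) (M1 + (1 + 1 / a) * M2) := by
      filter_upwards [h1, h2] with c' b1 b2 z
      have e1 := HasTwoDerivBounds.comp (x := (z, c')) (f := fun v : ℝ × V => v.2) b1
        (HasTwoDerivBounds.of_clm (ContinuousLinearMap.snd ℝ ℝ V) (z, c')
          (ContinuousLinearMap.norm_snd_le ℝ ℝ V))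
      have hs : HasTwoDerivBounds (fun t : ℝ => -(1 + 1 / a) * t) (Real.exp (a * L (z, c')))
          (1 + 1 / a) 0 := by
        have h3 : fderiv ℝ (fun t : ℝ => -(1 + 1 / a) * t)
            = fun _ => -(1 + 1 / a) • ContinuousLinearMap.id ℝ ℝ := by
          ext1 t
          exact ((-(1 + 1 / a)) • ContinuousLinearMap.id ℝ ℝ).fderiv
        refine (HasTwoDerivBounds.of_contDiffAt (by fun_prop)).mono ?_ ?_
        · rw [h3, norm_smul, norm_neg, Real.norm_of_nonneg (by positivity)]
          simp
        · rw [h3, fderiv_const_apply]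
          exact ContinuousLinearMap.opNorm_zero.le
      have e2 := hs.comp (f := fun v => Real.exp (a * L v)) (b2 z)
      exact (e1.add e2).mono (by simp) (by simp)
    refine ⟨_, nhdsWithin_le_nhds hev, max 0 (M1 + (1 + 1 / a) * M2), le_max_left _ _, ?_⟩
    exact fun c' hc' z => (hc' z).mono (le_max_right _ _) (le_max_right _ _)

/-- The Hessian bound for a family of densities which are log-affine in coefficients `c` depending
smoothly on the scale parameters. -/
lemma hessian_dpdH_bound {ι X W : Type*} [NormedAddCommGroup ι] [NormedSpace ℝ ι]
    [NormedAddCommGroup W] [NormedSpace ℝ W]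
    {L : ℝ × V → ℝ} (hL : HasPolyGrowthTwo L)
    {a : ℝ} (ha : 0 < a) {g : X → ι → ℝ} (hg1 : ∀ x, Differentiable ℝ (g x))
    (hg2 : ∀ x, Differentiable ℝ (fderiv ℝ (g x)))
    {f : ι × W → X → ℝ → ℝ} {c : W → V} {O K : Set W} (hO : IsOpen O) (hK : IsCompact K)
    (hKO : K ⊆ O) (hc : ContDiffOn ℝ 2 c O) (hd : ∀ w ∈ K, LocallyDecays L (c w))
    (hf : ∀ θ : ι × W, θ.2 ∈ O → ∀ x y, f θ x y = Real.exp (L (y - g x θ.1, c θ.2)))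
    (B : Set ι) :
    ∃ C : ℝ≥0∞, C ≠ ⊤ ∧ ∀ θ ∈ B ×ˢ K, ∀ (x : X) (y : ℝ),
      ENNReal.ofReal ‖fderiv ℝ (fderiv ℝ (fun t => dpdH a f t x y)) θ‖
        ≤ C * ENNReal.ofReal (1 + a) * (1
            + (⨆ β ∈ B, ENNReal.ofReal (‖fderiv ℝ (g x) β‖ ^ 2))
            + ⨆ β ∈ B, ENNReal.ofReal ‖fderiv ℝ (fderiv ℝ (g x)) β‖) := by
  have hcK : IsCompact (c '' K) := hK.image_of_continuousOn (hc.continuousOn.mono hKO)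
  obtain ⟨M, hM, hG⟩ := exists_hasTwoDerivBounds_residualObjective hL ha hcK
    (by rintro _ ⟨w, hw, rfl⟩; exact hd w hw)
  have hc1 : ContDiffOn ℝ 1 (fderiv ℝ c) O := hc.fderiv_of_isOpen hO (by norm_num)
  have hc2 : ContDiffOn ℝ 0 (fderiv ℝ (fderiv ℝ c)) O := hc1.fderiv_of_isOpen hO (by norm_num)
  obtain ⟨N1, hN1⟩ := hK.exists_bound_of_continuousOn (hc1.continuousOn.mono hKO)
  obtain ⟨N2, hN2⟩ := hK.exists_bound_of_continuousOn (f := fderiv ℝ (fderiv ℝ c)) (hc2.continuousOn.mono hKO)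
  set N : ℝ := max 0 (max N1 N2) with hN
  have hN0 : 0 ≤ N := le_max_left _ _
  have hcw : ∀ w ∈ K, HasTwoDerivBounds c w N N := fun w hw =>
    (HasTwoDerivBounds.of_contDiffAt (hc.contDiffAt (hO.mem_nhds (hKO hw)))).mono
      ((hN1 w hw).trans ((le_max_left _ _).trans (le_max_right _ _)))
      ((hN2 w hw).trans ((le_max_right _ _).trans (le_max_right _ _)))
  set C : ℝ := M * (2 + 2 * N ^ 2 + N) with hC
  refine ⟨ENNReal.ofReal C, ENNReal.ofReal_ne_top, ?_⟩
  rintro ⟨β, w⟩ ⟨hβ, hw⟩ x y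
  simp only at hβ hw
  set g1 : ℝ := ‖fderiv ℝ (g x) β‖ with hg1'
  set g2 : ℝ := ‖fderiv ℝ (fderiv ℝ (g x)) β‖ with hg2'
  have hgx : HasTwoDerivBounds (g x) β g1 g2 :=
    ⟨Eventually.of_forall fun b => hg1 x b, hg2 x β, le_rfl, le_rfl⟩
  have hres : HasTwoDerivBounds (fun b => y + -g x b) β g1 g2 := by
    have h1 : HasTwoDerivBounds (fun _ : ι => y) β 0 0 := by
      have h3 : fderiv ℝ (fun _ : ι => y) = fun _ => 0 := by ext1 b; simp
      refine (HasTwoDerivBounds.of_contDiffAt contDiffAt_const).mono ?_ ?_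
      · rw [h3]; simp
      · rw [h3, fderiv_const_apply]
        exact ContinuousLinearMap.opNorm_zero.le
    have h2 := (HasTwoDerivBounds.of_clm (-ContinuousLinearMap.id ℝ ℝ) (g x β)
      (by rw [norm_neg]; exact ContinuousLinearMap.norm_id_le)).comp hgx
    exact (h1.add h2).mono (by simp) (by simp)
  have hψ : HasTwoDerivBounds (fun θ : ι × W => (y - g x θ.1, c θ.2)) (β, w)
      (g1 + N) (g2 + N) := by
    have h1 := (HasTwoDerivBounds.of_clm (ContinuousLinearMap.inl ℝ ℝ V) _
      (ContinuousLinearMap.norm_inl_le_one ℝ ℝ V)).comp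
        (HasTwoDerivBounds.comp (x := ((β, w) : ι × W)) (f := fun θ : ι × W => θ.1) hres
          (HasTwoDerivBounds.of_clm (ContinuousLinearMap.fst ℝ ι W) (β, w)
            (ContinuousLinearMap.norm_fst_le ℝ ι W)))
    have h2 := (HasTwoDerivBounds.of_clm (ContinuousLinearMap.inr ℝ ℝ V) _
      (ContinuousLinearMap.norm_inr_le_one ℝ ℝ V)).comp
        (HasTwoDerivBounds.comp (x := ((β, w) : ι × W)) (f := fun θ : ι × W => θ.2) (hcw w hw)
          (HasTwoDerivBounds.of_clm (ContinuousLinearMap.snd ℝ ι W) (β, w)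
            (ContinuousLinearMap.norm_snd_le ℝ ι W)))
    refine ((h1.add h2).congr (Eventually.of_forall fun θ => ?_)).mono (by simp) (by simp)
    simp [sub_eq_add_neg]
  have hcomp := HasTwoDerivBounds.comp (x := ((β, w) : ι × W))
    (hG (c w) (mem_image_of_mem c hw) (y - g x β)) hψ
  have hev : (fun θ : ι × W => residualObjective a L (y - g x θ.1, c θ.2)) =ᶠ[𝓝 (β, w)]
      fun t => dpdH a f t x y := by
    have hO' : ∀ᶠ θ : ι × W in 𝓝 (β, w), θ.2 ∈ O :=
      continuous_snd.continuousAt.eventually (hO.mem_nhds (hKO hw))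
    filter_upwards [hO'] with θ hθ
    have h1 : ∀ r y', f θ x y' ^ r = Real.exp (r * L (y' - g x θ.1, c θ.2)) := fun r y' => by
      rw [hf θ hθ, ← Real.exp_mul, mul_comm]
    simp only [residualObjective, dpdH, h1]
    rw [integral_sub_right_eq_self (fun z => Real.exp ((1 + a) * L (z, c θ.2))) (g x θ.1)]
    ring
  have hfin := (hcomp.congr hev).norm_fderiv_fderiv_le
  have hg10 : 0 ≤ g1 := norm_nonneg _
  have hg20 : 0 ≤ g2 := norm_nonneg (fderiv ℝ (fderiv ℝ (g x)) β)
  have hle : M * (g1 + N) ^ 2 + M * (g2 + N) ≤ C * (1 + a) * (1 + g1 ^ 2 + g2) := by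
    have h1 : (g1 + N) ^ 2 + (g2 + N) ≤ (2 + 2 * N ^ 2 + N) * (1 + g1 ^ 2 + g2) := by
      nlinarith [sq_nonneg (g1 - N), mul_nonneg hN0 hg20, mul_nonneg hN0 (sq_nonneg g1),
        mul_nonneg (sq_nonneg N) hg20, mul_nonneg (sq_nonneg N) (sq_nonneg g1)]
    have h2 : 0 ≤ C * (1 + g1 ^ 2 + g2) * a := by positivity
    nlinarith [mul_le_mul_of_nonneg_left h1 hM]
  calc _ ≤ ENNReal.ofReal (C * (1 + a) * (1 + g1 ^ 2 + g2)) :=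
        ENNReal.ofReal_le_ofReal (hfin.trans hle)
    _ = ENNReal.ofReal C * ENNReal.ofReal (1 + a) *
          (1 + ENNReal.ofReal (g1 ^ 2) + ENNReal.ofReal g2) := by
        rw [ENNReal.ofReal_mul (by positivity), ENNReal.ofReal_mul (by positivity),
          ENNReal.ofReal_add (by positivity : 0 ≤ 1 + g1 ^ 2) hg20,
          ENNReal.ofReal_add zero_le_one (by positivity : 0 ≤ g1 ^ 2),
          ENNReal.ofReal_one]
    _ ≤ _ := by
        gcongr
        · exact le_iSup₂ (f := fun b (_ : b ∈ B) => ENNReal.ofReal (‖fderiv ℝ (g x) b‖ ^ 2)) β hβ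
        · exact le_iSup₂
            (f := fun b (_ : b ∈ B) => ENNReal.ofReal ‖fderiv ℝ (fderiv ℝ (g x)) b‖) β hβ

end Objective

lemma eventually_abs_apply_le {n : ℕ} (c : Fin n → ℝ) :
    ∀ᶠ c' in 𝓝 c, ∀ i, |c' i| ≤ ‖c‖ + 1 := by
  have h : ∀ᶠ c' in 𝓝 c, ‖c'‖ < ‖c‖ + 1 :=
    continuous_norm.continuousAt.eventually_lt continuousAt_const (by linarith)
  exact h.mono fun c' hc' i => (norm_le_pi_norm c' i).trans hc'.le

lemma locallyDecays_logKernel_of_ne_zero {c : Fin 5 → ℝ} (hc : c 2 ≠ 0) :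
    LocallyDecays logKernel c := by
  set M : ℝ := ‖c‖ + 1
  set e : ℝ := c 2 ^ 2 / 2 with he
  have he0 : 0 < e := by positivity
  have h2 : ∀ᶠ c' in 𝓝 c, e < c' 2 ^ 2 :=
    continuousAt_const.eventually_lt ((continuous_apply 2).pow 2).continuousAt
      (by change e < c 2 ^ 2; linarith)
  refine ⟨M + (M + 1) ^ 2 / (4 * e), 1, one_pos, ?_⟩
  filter_upwards [eventually_abs_apply_le c, h2] with c' hM h2 z
  have h3 : Real.log (stdGaussCdf (c' 3 + c' 4 * z)) ≤ 0 :=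
    Real.log_nonpos (stdGaussCdf_pos _).le (stdGaussCdf_le_one _)
  have h4 : c' 1 * z ≤ M * |z| := by
    calc c' 1 * z ≤ |c' 1 * z| := le_abs_self _
      _ = |c' 1| * |z| := abs_mul _ _
      _ ≤ _ := by gcongr; exact hM 1
  have h5 : c' 0 ≤ M := (le_abs_self _).trans (hM 0)
  have h6 : e * z ^ 2 ≤ c' 2 ^ 2 * z ^ 2 := by gcongr
  have h7 : (M + 1) * |z| ≤ e * z ^ 2 + (M + 1) ^ 2 / (4 * e) := by
    have : e * z ^ 2 + (M + 1) ^ 2 / (4 * e) - (M + 1) * |z|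
        = (2 * e * |z| - (M + 1)) ^ 2 / (4 * e) := by
      rw [← sq_abs z]
      field_simp
      ring
    have h8 : 0 ≤ (2 * e * |z| - (M + 1)) ^ 2 / (4 * e) := by positivity
    linarith
  simp only [logKernel]
  linarith

lemma locallyDecays_logKernel_of_pos_of_neg {c : Fin 5 → ℝ} (h1 : 0 < c 1) (h4 : c 4 < 0) :
    LocallyDecays logKernel c := by
  set M : ℝ := ‖c‖ + 1 with hM
  have hM0 : 0 < M := by positivity
  set e : ℝ := c 1 / 2 with he
  have he0 : 0 < e := by positivity
  set d : ℝ := - c 4 / 2 with hd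
  have hd0 : 0 < d := by linarith
  set k : ℝ := (M + 1) / d + 1 with hk
  have hk1 : 1 ≤ k := by
    have : 0 ≤ (M + 1) / d := by positivity
    linarith
  have hkd : M + 1 ≤ k * d := by
    have : (M + 1) / d * d = M + 1 := by field_simp
    nlinarith
  have e1 : ∀ᶠ c' in 𝓝 c, e < c' 1 :=
    continuousAt_const.eventually_lt (continuous_apply 1).continuousAt
      (by change e < c 1; linarith)
  have e4 : ∀ᶠ c' in 𝓝 c, c' 4 < -d :=
    (continuous_apply 4).continuousAt.eventually_lt continuousAt_const
      (by change c 4 < -d; linarith)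
  refine ⟨M + (k ^ 2 / 2 + k * M), min e 1, lt_min he0 one_pos, ?_⟩
  filter_upwards [eventually_abs_apply_le c, e1, e4] with c' hM' e1 e4 z
  have h0 : c' 0 ≤ M := (le_abs_self _).trans (hM' 0)
  have h2 : 0 ≤ c' 2 ^ 2 * z ^ 2 := by positivity
  simp only [logKernel]
  rcases le_total z 0 with hz | hz
  · have h3 : Real.log (stdGaussCdf (c' 3 + c' 4 * z)) ≤ 0 :=
      Real.log_nonpos (stdGaussCdf_pos _).le (stdGaussCdf_le_one _)
    have h5 : c' 1 * z ≤ e * z := mul_le_mul_of_nonpos_right e1.le hz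
    have h6 : min e 1 * |z| ≤ e * |z| :=
      mul_le_mul_of_nonneg_right (min_le_left _ _) (abs_nonneg z)
    have h7 : 0 ≤ k ^ 2 / 2 + k * M := by positivity
    rw [abs_of_nonpos hz] at h6 ⊢
    linarith
  · have h3 : Real.log (stdGaussCdf (c' 3 + c' 4 * z)) ≤ k ^ 2 / 2 + k * (c' 3 + c' 4 * z) := by
      rw [Real.log_le_iff_le_exp (stdGaussCdf_pos _), Real.exp_add]
      exact stdGaussCdf_le_exp_mul hk1 _
    have h5 : c' 1 * z ≤ M * z :=
      mul_le_mul_of_nonneg_right ((le_abs_self _).trans (hM' 1)) hz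
    have h6 : min e 1 * |z| ≤ 1 * |z| :=
      mul_le_mul_of_nonneg_right (min_le_right _ _) (abs_nonneg z)
    have hk0 : 0 ≤ k := by linarith
    have h7 : k * c' 3 ≤ k * M :=
      mul_le_mul_of_nonneg_left ((le_abs_self _).trans (hM' 3)) hk0
    have h8 : k * (c' 4 * z) ≤ -((M + 1) * z) := by
      have h9 : c' 4 * z ≤ -d * z := mul_le_mul_of_nonneg_right e4.le hz
      have h10 := mul_le_mul_of_nonneg_left h9 hk0
      have h11 := mul_le_mul_of_nonneg_right hkd hz
      linarith
    rw [abs_of_nonneg hz] at h6 ⊢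
    rw [mul_add] at h3
    linarith

/-- Coefficients of the log-density of the normal–truncated-normal model. -/
noncomputable def coeffNT (w : ℝ × ℝ × ℝ) : Fin 5 → ℝ :=
  let σ := Real.sqrt (w.2.1 ^ 2 + w.2.2 ^ 2)
  ![-Real.log σ - Real.log (stdGaussCdf (w.1 / w.2.2)) - Real.log (Real.sqrt (2 * Real.pi))
      - w.1 ^ 2 / (2 * σ ^ 2),
    -(w.1 / σ ^ 2), (Real.sqrt 2 * σ)⁻¹, w.1 / (σ * (w.2.2 / w.2.1)), -(w.2.2 / w.2.1 / σ)]

/-- Coefficients of the log-density of the normal–exponential model. -/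
noncomputable def coeffNE (w : ℝ × ℝ) : Fin 5 → ℝ :=
  ![w.1 ^ 2 / (2 * w.2 ^ 2) - Real.log w.2, w.2⁻¹, 0, -(w.1 / w.2), -w.1⁻¹]

lemma contDiffOn_coeffNT :
    ContDiffOn ℝ 2 coeffNT {w | 0 < w.2.1 ∧ 0 < w.2.2} := by
  rintro w ⟨h1, h2⟩
  refine ContDiffAt.contDiffWithinAt ?_
  have hw1 : ContDiffAt ℝ 2 (fun w : ℝ × ℝ × ℝ => w.1) w := by fun_prop
  have hv : ContDiffAt ℝ 2 (fun w : ℝ × ℝ × ℝ => w.2.1) w := by fun_prop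
  have hu : ContDiffAt ℝ 2 (fun w : ℝ × ℝ × ℝ => w.2.2) w := by fun_prop
  have hs0 : w.2.1 ^ 2 + w.2.2 ^ 2 ≠ 0 := by positivity
  have hσ : ContDiffAt ℝ 2 (fun w : ℝ × ℝ × ℝ => Real.sqrt (w.2.1 ^ 2 + w.2.2 ^ 2)) w :=
    ((hv.pow 2).add (hu.pow 2)).sqrt hs0
  have hσ0 : Real.sqrt (w.2.1 ^ 2 + w.2.2 ^ 2) ≠ 0 := by positivity
  have hΦ : ContDiffAt ℝ 2 (fun w : ℝ × ℝ × ℝ => Real.log (stdGaussCdf (w.1 / w.2.2))) w :=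
    contDiff_log_stdGaussCdf.contDiffAt.comp w (hw1.div hu h2.ne')
  rw [contDiffAt_pi]
  intro i
  fin_cases i
  · exact (((hσ.log hσ0).neg.sub hΦ).sub contDiffAt_const).sub
      ((hw1.pow 2).div (contDiffAt_const.mul (hσ.pow 2)) (by positivity))
  · exact (hw1.div (hσ.pow 2) (by positivity)).neg
  · exact (contDiffAt_const.mul hσ).inv (by positivity)
  · exact hw1.div (hσ.mul (hu.div hv h1.ne')) (by positivity)
  · exact ((hu.div hv h1.ne').div hσ hσ0).neg

lemma contDiffOn_coeffNE :
    ContDiffOn ℝ 2 coeffNE {w | 0 < w.1 ∧ 0 < w.2} := by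
  rintro w ⟨h1, h2⟩
  refine ContDiffAt.contDiffWithinAt ?_
  have hv : ContDiffAt ℝ 2 (fun w : ℝ × ℝ => w.1) w := by fun_prop
  have hu : ContDiffAt ℝ 2 (fun w : ℝ × ℝ => w.2) w := by fun_prop
  rw [contDiffAt_pi]
  intro i
  fin_cases i
  · exact ((hv.pow 2).div (contDiffAt_const.mul (hu.pow 2)) (by positivity)).sub (hu.log h2.ne')
  · exact hu.inv h2.ne'
  · exact contDiffAt_const
  · exact (hv.div hu h2.ne').neg
  · exact (hv.inv h1.ne').neg

lemma fNT_eq_exp_logKernel {p q : ℕ} (g : (Fin p → ℝ) → (Fin q → ℝ) → ℝ)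
    (θ : (Fin q → ℝ) × ℝ × ℝ × ℝ) (hθ : θ.2 ∈ {w : ℝ × ℝ × ℝ | 0 < w.2.1 ∧ 0 < w.2.2})
    (x : Fin p → ℝ) (y : ℝ) :
    fNT g θ x y = Real.exp (logKernel (y - g x θ.1, coeffNT θ.2)) := by
  obtain ⟨β, μ, v, u⟩ := θ
  obtain ⟨hv, hu⟩ := hθ
  simp only at hv hu
  set σ : ℝ := Real.sqrt (v ^ 2 + u ^ 2) with hσ
  have hσ0 : 0 < σ := by positivity
  simp only [fNT, one_sub_stdGaussCdf_neg, stdGaussPdf, logKernel, coeffNT, ← hσ]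
  set z : ℝ := y - g x β
  have h2 : Real.sqrt 2 ^ 2 = 2 := Real.sq_sqrt (by norm_num)
  have hΦ := stdGaussCdf_pos (μ / u)
  have e : (-Real.log σ - Real.log (stdGaussCdf (μ / u)) - Real.log (Real.sqrt (2 * Real.pi))
      - μ ^ 2 / (2 * σ ^ 2)) + -(μ / σ ^ 2) * z - ((Real.sqrt 2 * σ)⁻¹) ^ 2 * z ^ 2
      + Real.log (stdGaussCdf (μ / (σ * (u / v)) + -(u / v / σ) * z))
      = Real.log σ⁻¹ + Real.log (stdGaussCdf (μ / u))⁻¹ + (Real.log (Real.sqrt (2 * Real.pi))⁻¹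
      + -(((z + μ) / σ) ^ 2) / 2)
      + Real.log (stdGaussCdf (μ / (σ * (u / v)) - u / v * z / σ)) := by
    rw [show μ / (σ * (u / v)) + -(u / v / σ) * z = μ / (σ * (u / v)) - u / v * z / σ by ring,
      Real.log_inv, Real.log_inv, Real.log_inv, inv_pow, mul_pow, h2]
    field_simp
    ring
  have e' := congrArg Real.exp e
  rw [Real.exp_add (_ + _ + _), Real.exp_add (_ + _), Real.exp_add (Real.log _),
    Real.exp_add (Real.log _), Real.exp_log (by positivity), Real.exp_log (by positivity),
    Real.exp_log (by positivity), Real.exp_log (stdGaussCdf_pos _)] at e'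
  exact e'.symm

lemma fNE_eq_exp_logKernel {p q : ℕ} (g : (Fin p → ℝ) → (Fin q → ℝ) → ℝ)
    (θ : (Fin q → ℝ) × ℝ × ℝ) (hθ : θ.2 ∈ {w : ℝ × ℝ | 0 < w.1 ∧ 0 < w.2})
    (x : Fin p → ℝ) (y : ℝ) :
    fNE g θ x y = Real.exp (logKernel (y - g x θ.1, coeffNE θ.2)) := by
  obtain ⟨β, v, u⟩ := θ
  obtain ⟨hv, hu⟩ := hθ
  simp only at hv hu
  simp only [fNE, logKernel, coeffNE]
  set z : ℝ := y - g x β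
  have e : (v ^ 2 / (2 * u ^ 2) - Real.log u) + u⁻¹ * z - 0 ^ 2 * z ^ 2
      + Real.log (stdGaussCdf (-(v / u) + -v⁻¹ * z))
      = Real.log u⁻¹ + Real.log (stdGaussCdf (-(z / v) - v / u))
      + (z / u + v ^ 2 / (2 * u ^ 2)) := by
    rw [show -(v / u) + -v⁻¹ * z = -(z / v) - v / u by ring, Real.log_inv]
    ring
  have e' := congrArg Real.exp e
  rw [Real.exp_add (_ + _), Real.exp_add (Real.log _), Real.exp_log (by positivity),
    Real.exp_log (stdGaussCdf_pos _)] at e'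
  exact e'.symm

/-- for the normal–truncated-normal and normal–exponential pseudo
conditional densities, with Θ the compact box and g(x,β) twice differentiable in β,
for every α > 0 there is a finite constant C with
‖∂²_{θθᵀ} H_α(x,y;θ)‖ ≤ C (1+α) (1 + sup_{θ∈Θ} ‖∂_β g ∂_{βᵀ} g‖ + sup_{θ∈Θ} ‖∂²_{ββᵀ} g‖)
for all θ ∈ Θ and all (x,y) (suprema in [0,∞]; the norm of the outer product
∂_β g ∂_{βᵀ} g is ‖∂_β g‖²). -/
theorem hessian_of_H_alpha_bound {p q : ℕ} (g : (Fin p → ℝ) → (Fin q → ℝ) → ℝ)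
    (hg1 : ∀ x, Differentiable ℝ (g x))
    (hg2 : ∀ x, Differentiable ℝ (fderiv ℝ (g x)))
    (a : ℝ) (ha : 0 < a)
    (bl bu ul uu sl su : ℝ) (hsl : 0 < sl) (hs : sl ≤ su) :
    (∃ C : ℝ≥0∞, C ≠ ⊤ ∧ ∀ θ ∈ boxNT q bl bu ul uu sl su, ∀ (x : Fin p → ℝ) (y : ℝ),
        ENNReal.ofReal ‖fderiv ℝ (fderiv ℝ (fun t => dpdH a (fNT g) t x y)) θ‖
          ≤ C * ENNReal.ofReal (1 + a) * (1
              + (⨆ β ∈ Set.Icc (fun _ : Fin q => bl) (fun _ => bu),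
                  ENNReal.ofReal (‖fderiv ℝ (g x) β‖ ^ 2))
              + ⨆ β ∈ Set.Icc (fun _ : Fin q => bl) (fun _ => bu),
                  ENNReal.ofReal ‖fderiv ℝ (fderiv ℝ (g x)) β‖))
    ∧ (∃ C : ℝ≥0∞, C ≠ ⊤ ∧ ∀ θ ∈ boxNE q bl bu sl su, ∀ (x : Fin p → ℝ) (y : ℝ),
        ENNReal.ofReal ‖fderiv ℝ (fderiv ℝ (fun t => dpdH a (fNE g) t x y)) θ‖
          ≤ C * ENNReal.ofReal (1 + a) * (1
              + (⨆ β ∈ Set.Icc (fun _ : Fin q => bl) (fun _ => bu),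
                  ENNReal.ofReal (‖fderiv ℝ (g x) β‖ ^ 2))
              + ⨆ β ∈ Set.Icc (fun _ : Fin q => bl) (fun _ => bu),
                  ENNReal.ofReal ‖fderiv ℝ (fderiv ℝ (g x)) β‖)) := by
  refine ⟨?_, ?_⟩
  · refine hessian_dpdH_bound hasPolyGrowthTwo_logKernel ha hg1 hg2
      (O := {w : ℝ × ℝ × ℝ | 0 < w.2.1 ∧ 0 < w.2.2}) (c := coeffNT) ?_
      (isCompact_Icc.prod (isCompact_Icc.prod isCompact_Icc)) ?_ contDiffOn_coeffNT ?_
      (fNT_eq_exp_logKernel g) _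
    · exact (isOpen_lt continuous_const (continuous_fst.comp continuous_snd)).inter
        (isOpen_lt continuous_const (continuous_snd.comp continuous_snd))
    · rintro w ⟨-, h1, h2⟩
      exact ⟨hsl.trans_le h1.1, hsl.trans_le h2.1⟩
    · rintro w ⟨-, h1, h2⟩
      have hv : 0 < w.2.1 := hsl.trans_le h1.1
      refine locallyDecays_logKernel_of_ne_zero ?_
      change (Real.sqrt 2 * Real.sqrt (w.2.1 ^ 2 + w.2.2 ^ 2))⁻¹ ≠ 0
      positivity
  · refine hessian_dpdH_bound hasPolyGrowthTwo_logKernel ha hg1 hg2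
      (O := {w : ℝ × ℝ | 0 < w.1 ∧ 0 < w.2}) (c := coeffNE) ?_
      (isCompact_Icc.prod isCompact_Icc) ?_ contDiffOn_coeffNE ?_
      (fNE_eq_exp_logKernel g) _
    · exact (isOpen_lt continuous_const continuous_fst).inter
        (isOpen_lt continuous_const continuous_snd)
    · rintro w ⟨h1, h2⟩
      exact ⟨hsl.trans_le h1.1, hsl.trans_le h2.1⟩
    · rintro w ⟨h1, h2⟩
      exact locallyDecays_logKernel_of_pos_of_neg
        (inv_pos.2 (hsl.trans_le h2.1)) (neg_lt_zero.2 (inv_pos.2 (hsl.trans_le h1.1)))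
end

section
/- Let α > 0 and let g and f be probability density functions on ℝ such that f^{1+α}, g·f^α and g^{1+α} are integrable. Then the density power divergence d_α(g,f) = ∫{f^{1+α}(z) − (1+1/α) g(z) f^α(z) + (1/α) g^{1+α}(z)} dz satisfies d_α(g,f) ≥ 0, with d_α(g,f) = 0 if and only if g = f almost everywhere (with respect to Lebesgue measure). In particular, if a parametric family {f_θ : θ ∈ Θ} contains the true density, i.e. g = f_{θ'} for some θ' ∈ Θ, then θ' minimizes θ ↦ d_α(g, f_θ) over Θ. -/
open MeasureTheory Real Set

/-- The density power divergence d_α(g,f) of Basu et al. (1998) between two densities on ℝ. -/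
noncomputable def dpd (a : ℝ) (gd f : ℝ → ℝ) : ℝ :=
  ∫ z : ℝ, (f z ^ (1 + a) - (1 + 1 / a) * gd z * f z ^ a + (1 / a) * gd z ^ (1 + a))

theorem dpd_integrand_self {a : ℝ} (ha : 0 < a) {x : ℝ} (hx : 0 ≤ x) :
    x ^ (1 + a) - (1 + 1 / a) * x * x ^ a + (1 / a) * x ^ (1 + a) = 0 := by
  rw [rpow_one_add' hx (by positivity)]
  ring

theorem dpd_integrand_pos_of_ne {a : ℝ} (ha : 0 < a) {x y : ℝ} (hx : 0 ≤ x) (hy : 0 ≤ y)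
    (hxy : y ≠ x) :
    0 < x ^ (1 + a) - (1 + 1 / a) * y * x ^ a + (1 / a) * y ^ (1 + a) := by
  rcases hx.eq_or_lt with rfl | hx
  · have hy : 0 < y := hy.lt_of_ne' hxy
    rw [zero_rpow (by positivity), zero_rpow ha.ne']
    simp only [mul_zero, sub_zero, zero_add]
    positivity
  · have bernoulli : 1 + (1 + a) * (y / x - 1) < (1 + (y / x - 1)) ^ (1 + a) := by
      refine one_add_mul_self_lt_rpow_one_add ?_ ?_ (by linarith)
      · linarith [div_nonneg hy hx.le]
      · rwa [sub_ne_zero, ne_eq, div_eq_one_iff_eq hx.ne']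
    rw [add_sub_cancel, div_rpow hy hx.le, lt_div_iff₀ (by positivity),
      rpow_one_add' hx.le (by positivity)] at bernoulli
    have key : 0 < (1 / a) *
        (y ^ (1 + a) - (1 + (1 + a) * (y / x - 1)) * (x * x ^ a)) :=
      mul_pos (by positivity) (sub_pos.mpr bernoulli)
    rw [rpow_one_add' hx.le (by positivity)]
    convert key using 1
    field_simp
    ring

theorem dpd_integrand_nonneg {a : ℝ} (ha : 0 < a) {x y : ℝ} (hx : 0 ≤ x) (hy : 0 ≤ y) :
    0 ≤ x ^ (1 + a) - (1 + 1 / a) * y * x ^ a + (1 / a) * y ^ (1 + a) := by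
  rcases eq_or_ne y x with rfl | hxy
  · exact (dpd_integrand_self ha hx).ge
  · exact (dpd_integrand_pos_of_ne ha hx hy hxy).le

theorem dpd_integrand_eq_zero_iff {a : ℝ} (ha : 0 < a) {x y : ℝ} (hx : 0 ≤ x) (hy : 0 ≤ y) :
    x ^ (1 + a) - (1 + 1 / a) * y * x ^ a + (1 / a) * y ^ (1 + a) = 0 ↔ y = x := by
  refine ⟨fun h => ?_, ?_⟩
  · by_contra hxy
    exact (dpd_integrand_pos_of_ne ha hx hy hxy).ne' h
  · rintro rfl
    exact dpd_integrand_self ha hx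

theorem dpd_nonneg {a : ℝ} (ha : 0 < a) {gd f : ℝ → ℝ}
    (hg : ∀ z, 0 ≤ gd z) (hf : ∀ z, 0 ≤ f z) : 0 ≤ dpd a gd f :=
  integral_nonneg fun z => dpd_integrand_nonneg ha (hf z) (hg z)

theorem dpd_self {a : ℝ} (ha : 0 < a) {gd : ℝ → ℝ} (hg : ∀ z, 0 ≤ gd z) : dpd a gd gd = 0 := by
  simp only [dpd, dpd_integrand_self ha (hg _), integral_zero]

theorem dpd_eq_zero_iff {a : ℝ} (ha : 0 < a) {gd f : ℝ → ℝ}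
    (hg : ∀ z, 0 ≤ gd z) (hf : ∀ z, 0 ≤ f z)
    (h1 : Integrable fun z => f z ^ (1 + a))
    (h2 : Integrable fun z => gd z * f z ^ a)
    (h3 : Integrable fun z => gd z ^ (1 + a)) :
    dpd a gd f = 0 ↔ gd =ᵐ[volume] f := by
  have hint : Integrable fun z =>
      f z ^ (1 + a) - (1 + 1 / a) * gd z * f z ^ a + (1 / a) * gd z ^ (1 + a) := by
    simp only [mul_assoc (1 + 1 / a)]
    exact (h1.sub (h2.const_mul _)).add (h3.const_mul _)
  rw [dpd, integral_eq_zero_iff_of_nonneg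
    (fun z => dpd_integrand_nonneg ha (hf z) (hg z)) hint]
  exact Filter.eventually_congr
    (.of_forall fun z => dpd_integrand_eq_zero_iff ha (hf z) (hg z))

/-- for α > 0 and probability densities g, f on ℝ with f^{1+α}, g f^α and
g^{1+α} integrable, the density power divergence satisfies d_α(g,f) ≥ 0, with equality
iff g = f Lebesgue-a.e.; in particular if a parametric family {f_θ} contains the true
density g = f_{θ'}, then θ' minimizes θ ↦ d_α(g, f_θ) over Θ. -/
theorem dpd_nonneg_eq_zero_iff (a : ℝ) (ha : 0 < a) (gd f : ℝ → ℝ)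
    (hgm : Measurable gd) (hfm : Measurable f)
    (hgnn : ∀ z, 0 ≤ gd z) (hfnn : ∀ z, 0 ≤ f z)
    (hgint : Integrable gd) (hfint : Integrable f)
    (hg1 : ∫ z : ℝ, gd z = 1) (hf1 : ∫ z : ℝ, f z = 1)
    (h1 : Integrable fun z => f z ^ (1 + a))
    (h2 : Integrable fun z => gd z * f z ^ a)
    (h3 : Integrable fun z => gd z ^ (1 + a)) :
    0 ≤ dpd a gd f
    ∧ (dpd a gd f = 0 ↔ gd =ᵐ[volume] f)
    ∧ ∀ {ι : Type} (Θ : Set ι) (F : ι → ℝ → ℝ), ∀ θ' ∈ Θ,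
        (∀ θ ∈ Θ, Measurable (F θ) ∧ (∀ z, 0 ≤ F θ z) ∧ Integrable (F θ) ∧
          (∫ z : ℝ, F θ z = 1) ∧ Integrable (fun z => F θ z ^ (1 + a)) ∧
          Integrable (fun z => gd z * F θ z ^ a)) →
        gd = F θ' → ∀ θ ∈ Θ, dpd a gd (F θ') ≤ dpd a gd (F θ) := by
  refine ⟨dpd_nonneg ha hgnn hfnn, dpd_eq_zero_iff ha hgnn hfnn h1 h2 h3, ?_⟩
  rintro ι Θ F θ' _ hF rfl θ hθ
  rw [dpd_self ha hgnn]
  exact dpd_nonneg ha hgnn (hF θ hθ).2.1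
end
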